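/- (Content of Corollary 1: simultaneous near-diagonal effective channel.) Let r ≥ 2, K ≥ r − 1, and let α : Fin K → ℝ be such that the family (1, α 0, …, α (K−1)) is linearly independent over ℚ. Let g(a, n) = 1 + cos(2·π·n·a). Then for every δ > 0 there exist positive integers n_1, …, n_{r−1} such that for every i ∈ {1, …, r−1}: g(α k, n_i) < δ for all k ≠ i (k ranging over all K indices), and g(α i, n_i) > 1 − δ. In other words, the (r−1) × K effective gain matrix G with G_{i,k} = g(α k, n_i) has all entries in columns r, …, K and all off-diagonal entries of its leading (r−1) × (r−1) block smaller than δ, while its diagonal entries exceed 1 − δ. -/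

import Mathlib

/-- Squared beam-pattern gain of the two-element beamformer `w_n = (e₀ + e_n)/√2`
at a direction with cosine `a`: `g(a, n) = 1 + cos(2πna)`. -/
noncomputable def arrayGain (a : ℝ) (n : ℕ) : ℝ :=
  1 + Real.cos (2 * Real.pi * n * a)

namespace UnitAddTorus

open MeasureTheory Filter

variable {d : Type*} [Fintype d]

lemma mFourier_apply_add (m : d → ℤ) (x y : UnitAddTorus d) :
    mFourier m (x + y) = mFourier m x * mFourier m y := by
  simp [mFourier, AddCircle.toCircle_add, smul_add, Finset.prod_mul_distrib]

lemma mFourier_apply_coe (m : d → ℤ) (a : d → ℝ) :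
    mFourier m (fun k => (a k : UnitAddCircle)) =
      Complex.exp (2 * Real.pi * Complex.I * (∑ k, m k * a k : ℝ)) := by
  simp only [mFourier, ContinuousMap.coe_mk, fourier_coe_apply, ← Complex.exp_sum]
  congr 1
  push_cast
  rw [Finset.mul_sum]
  exact Finset.sum_congr rfl fun k _ => by ring

/-- The Fourier coefficients are equivariant under translation. -/
lemma mFourierCoeff_comp_add_right (f : UnitAddTorus d → ℂ) (a : UnitAddTorus d) (m : d → ℤ) :
    mFourierCoeff (fun x => f (x + a)) m = mFourier m a * mFourierCoeff f m := by
  have key : ∀ x, mFourier (-m) x • f (x + a) =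
      mFourier m a * (mFourier (-m) (x + a) • f (x + a)) := fun x => by
    have h : mFourier m a * mFourier (-m) a = 1 := by
      rw [← mFourier_add, add_neg_cancel, mFourier_zero, ContinuousMap.one_apply]
    simp only [mFourier_apply_add, smul_eq_mul]
    linear_combination (-(mFourier (-m) x * f (x + a))) * h
  simp only [mFourierCoeff, key]
  rw [integral_const_mul]
  congr 1
  exact integral_add_right_eq_self
    (μ := Measure.pi fun _ : d => (AddCircle.haarAddCircle : Measure UnitAddCircle))
    (fun x => mFourier (-m) x • f x) a

/-- A continuous function invariant under a translation that no nontrivial character kills is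
constant. -/
lemma eq_of_forall_apply_add_eq {a : UnitAddTorus d} (ha : ∀ m : d → ℤ, mFourier m a = 1 → m = 0)
    (f : C(UnitAddTorus d, ℂ)) (hf : ∀ x, f (x + a) = f x) (x y : UnitAddTorus d) : f x = f y := by
  have hzero : ∀ m ≠ 0, mFourierCoeff f m = 0 := fun m hm => by
    have h := mFourierCoeff_comp_add_right f a m
    simp only [hf] at h
    by_contra h0
    exact hm (ha m (mul_right_cancel₀ h0 (by rw [one_mul]; exact h.symm)))
  have hconst : ∀ z, f z = mFourierCoeff f 0 := fun z => by
    have h := hasSum_mFourier_series_apply_of_summable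
      (summable_of_ne_finset_zero (s := {0}) fun m hm => hzero m (by simpa using hm)) z
    refine h.unique ?_
    convert hasSum_single (0 : d → ℤ) fun m hm => ?_ using 1
    · simp [mFourier_zero]
    · simp [hzero m hm]
  rw [hconst x, hconst y]

/-- If no nontrivial character kills `a`, the multiples of `a` are dense in the torus. -/
lemma topologicalClosure_zmultiples_eq_top {a : UnitAddTorus d}
    (ha : ∀ m : d → ℤ, mFourier m a = 1 → m = 0) :
    (AddSubgroup.zmultiples a).topologicalClosure = ⊤ := by
  set H := (AddSubgroup.zmultiples a).topologicalClosure with hH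
  have haH : a ∈ H := AddSubgroup.le_topologicalClosure _ (AddSubgroup.mem_zmultiples a)
  have himage : (fun x => x + a) '' (H : Set (UnitAddTorus d)) = H := by
    ext x
    refine ⟨?_, fun hx => ⟨x - a, H.sub_mem hx haH, sub_add_cancel x a⟩⟩
    rintro ⟨y, hy, rfl⟩
    exact H.add_mem hy haH
  have hinv : ∀ x, Metric.infDist (x + a) H = Metric.infDist x H := fun x => by
    conv_lhs => rw [← himage]
    exact Metric.infDist_image (IsometryEquiv.addRight a).isometry
  let f : C(UnitAddTorus d, ℂ) :=
    ⟨fun x => (Metric.infDist x (H : Set (UnitAddTorus d)) : ℂ),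
      Complex.continuous_ofReal.comp (Metric.continuous_infDist_pt _)⟩
  rw [eq_top_iff]
  intro x _
  have hclosed : IsClosed (H : Set (UnitAddTorus d)) :=
    AddSubgroup.isClosed_topologicalClosure _
  refine (hclosed.mem_iff_infDist_zero ⟨0, H.zero_mem⟩).2 ?_
  have hx : f x = f 0 := eq_of_forall_apply_add_eq ha f (fun z => by simp [f, hinv z]) x 0
  have h0 : Metric.infDist 0 (H : Set (UnitAddTorus d)) = 0 :=
    Metric.infDist_zero_of_mem H.zero_mem
  exact (Complex.ofReal_injective hx).trans h0

/-- **Kronecker's approximation theorem**: if the reals `a k` are rationally independent together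
with `1`, some positive multiple of `a` falls modulo `1` into any given nonempty open set. -/
theorem exists_pos_nsmul_mem_of_linearIndependent {K : ℕ} {a : Fin K → ℝ}
    (ha : LinearIndependent ℚ (Fin.cons (1 : ℝ) a : Fin (K + 1) → ℝ))
    {U : Set (UnitAddTorus (Fin K))} (hU : IsOpen U) (hne : U.Nonempty) :
    ∃ n : ℕ, 0 < n ∧ (fun k => ((n * a k : ℝ) : UnitAddCircle)) ∈ U := by
  have hchar : ∀ m : Fin K → ℤ, mFourier m (fun k => (a k : UnitAddCircle)) = 1 → m = 0 := by
    intro m hm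
    rw [mFourier_apply_coe, Complex.exp_eq_one_iff] at hm
    obtain ⟨j, hj⟩ := hm
    have hsum : ∑ k, m k * a k = (j : ℝ) := by
      have h : (2 * Real.pi * Complex.I : ℂ) * ((∑ k, m k * a k : ℝ) : ℂ) =
          2 * Real.pi * Complex.I * (j : ℝ) := by
        rw [hj]; push_cast; ring
      exact_mod_cast mul_left_cancel₀ Complex.two_pi_I_ne_zero h
    have h := Fintype.linearIndependent_iff.1 ha (Fin.cons (-j : ℚ) fun k => (m k : ℚ)) (by
      simp [Fin.sum_univ_succ, Rat.smul_def, hsum])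
    funext k
    simpa using h k.succ
  obtain ⟨x, hx⟩ := hne
  have hcl : MapClusterPt x atTop fun n : ℕ => n • fun k => (a k : UnitAddCircle) := by
    rw [mapClusterPt_atTop_nsmul_iff_mem_topologicalClosure_zmultiples,
      topologicalClosure_zmultiples_eq_top hchar]
    trivial
  obtain ⟨n, hnU, hn⟩ :=
    ((hcl.frequently (hU.mem_nhds hx)).and_eventually (eventually_gt_atTop 0)).exists
  refine ⟨n, hn, ?_⟩
  have hmul : (fun k => ((n * a k : ℝ) : UnitAddCircle)) = n • fun k => (a k : UnitAddCircle) := by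
    funext k
    rw [Pi.smul_apply, ← AddCircle.coe_nsmul, nsmul_eq_mul]
  rw [hmul]
  exact hnU

end UnitAddTorus

lemma arrayGain_eq_re_fourier (a : ℝ) (n : ℕ) :
    arrayGain a n = 1 + (fourier 1 ((n * a : ℝ) : UnitAddCircle) : ℂ).re := by
  rw [arrayGain, fourier_coe_apply, ← Complex.exp_ofReal_mul_I_re]
  congr 3
  push_cast
  ring

/-- **Content of Corollary 1 (simultaneous near-diagonal effective channel).**
With `r - 1` desired users among `K` users whose direction cosines, together with `1`,
are linearly independent over `ℚ`, for every `δ > 0` one can choose antenna spacings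
`n 1, …, n (r-1)` so that beamformer `i` has gain `> 1 - δ` at the `i`-th desired user
and gain `< δ` at every other one of the `K` users. -/
theorem exists_near_diagonal_effective_channel
    (r K : ℕ) (hr : 2 ≤ r) (hK : r - 1 ≤ K) (α : Fin K → ℝ)
    (hα : LinearIndependent ℚ (Fin.cons (1 : ℝ) α : Fin (K + 1) → ℝ))
    (δ : ℝ) (hδ : 0 < δ) :
    ∃ n : Fin (r - 1) → ℕ, (∀ i, 0 < n i) ∧
      ∀ i : Fin (r - 1),
        (∀ k : Fin K, k ≠ Fin.castLE hK i → arrayGain (α k) (n i) < δ) ∧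
        arrayGain (α (Fin.castLE hK i)) (n i) > 1 - δ := by
  have hcont : Continuous fun x : UnitAddCircle => 1 + (fourier 1 x : ℂ).re := by fun_prop
  have key : ∀ i : Fin K, ∃ n : ℕ, 0 < n ∧
      (∀ k, k ≠ i → arrayGain (α k) n < δ) ∧ 1 - δ < arrayGain (α i) n := by
    intro i
    let V : Fin K → Set UnitAddCircle := fun k =>
      if k = i then {x | 1 - δ < 1 + (fourier 1 x : ℂ).re} else {x | 1 + (fourier 1 x : ℂ).re < δ}
    have hV : ∀ k, IsOpen (V k) := fun k => by
      dsimp only [V]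
      split_ifs
      · exact isOpen_lt continuous_const hcont
      · exact isOpen_lt hcont continuous_const
    have hVne : ∀ k, (V k).Nonempty := fun k => by
      dsimp only [V]
      split_ifs
      · refine ⟨0, ?_⟩
        simp only [Set.mem_ofPred_eq, fourier_eval_zero, Complex.one_re]
        linarith
      · refine ⟨((1 / 2 : ℝ) : UnitAddCircle), ?_⟩
        have h := arrayGain_eq_re_fourier (1 / 2) 1
        rw [Nat.cast_one, one_mul] at h
        rw [Set.mem_ofPred_eq, ← h, arrayGain]
        have h2 : 2 * Real.pi * (1 : ℕ) * (1 / 2) = Real.pi := by push_cast; ring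
        rw [h2, Real.cos_pi]
        linarith
    obtain ⟨n, hn, hmem⟩ := UnitAddTorus.exists_pos_nsmul_mem_of_linearIndependent hα
      (isOpen_set_pi Set.finite_univ fun k _ => hV k)
      (Set.univ_pi_nonempty_iff.2 hVne)
    refine ⟨n, hn, fun k hk => ?_, ?_⟩
    · have h := hmem k trivial
      simp only [V, if_neg hk] at h
      rw [arrayGain_eq_re_fourier]
      exact h
    · have h := hmem i trivial
      simp only [V, if_true] at h
      rw [arrayGain_eq_re_fourier]
      exact h
  choose n hn hoff hdiag using key
  exact ⟨fun i => n (Fin.castLE hK i), fun i => hn _, fun i => ⟨hoff _, hdiag _⟩⟩
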